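/- Fix τ ∈ ℂ with Im τ > 0, and let z₁, z₂, w₁, w₂ ∈ ℂ be such that none of z₁, z₂, w₁, w₂, w₁ + w₂, z₁ − z₂ lies in the lattice ℤ + τℤ. Then the function σ_w(z|τ) := ϑ1(z−w|τ) ϑ1′(0|τ) / (ϑ1(z|τ) ϑ1(−w|τ)) satisfies the three-term identity σ_{w₁}(z₁|τ) σ_{w₂}(z₂|τ) = σ_{w₁+w₂}(z₁|τ) σ_{w₂}(z₂−z₁|τ) + σ_{w₁+w₂}(z₂|τ) σ_{w₁}(z₁−z₂|τ). -/

import Mathlib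

open Complex

/-- The Jacobi theta function
`ϑ₁(z|τ) = −i Σ_{n∈ℤ} (−1)^n exp(πiτ(n+1/2)² + (2n+1)πiz)`. -/
noncomputable def jacobiTheta1 (z τ : ℂ) : ℂ :=
  -I * ∑' n : ℤ, (-1 : ℂ) ^ n *
    Complex.exp ((Real.pi : ℂ) * I * τ * ((n : ℂ) + 1 / 2) ^ 2 +
      (2 * (n : ℂ) + 1) * (Real.pi : ℂ) * I * z)

/-- The Jacobi theta function `ϑ₄(z|τ) = Σ_{n∈ℤ} (−1)^n exp(πiτn² + 2πinz)`. -/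
noncomputable def jacobiTheta4 (z τ : ℂ) : ℂ :=
  ∑' n : ℤ, (-1 : ℂ) ^ n *
    Complex.exp ((Real.pi : ℂ) * I * τ * (n : ℂ) ^ 2 + 2 * (Real.pi : ℂ) * I * (n : ℂ) * z)

/-- The lattice `ℤ + τℤ ⊂ ℂ`. -/
def latticeZtau (τ : ℂ) : Set ℂ := {u | ∃ m n : ℤ, u = (m : ℂ) + (n : ℂ) * τ}

/-- `ϑ₁′(0|τ)`, the derivative of `z ↦ ϑ₁(z|τ)` at `z = 0`. -/
noncomputable def jacobiTheta1'zero (τ : ℂ) : ℂ := deriv (fun z => jacobiTheta1 z τ) 0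

/-- `σ_w(z|τ) = ϑ₁(z−w|τ) ϑ₁′(0|τ) / (ϑ₁(z|τ) ϑ₁(−w|τ))`. -/
noncomputable def sigmaTheta (w z τ : ℂ) : ℂ :=
  jacobiTheta1 (z - w) τ * jacobiTheta1'zero τ / (jacobiTheta1 z τ * jacobiTheta1 (-w) τ)

noncomputable def thS0 (τ x : ℂ) : ℂ := jacobiTheta₂ (2 * x) (2 * τ)

noncomputable def thS1 (τ x : ℂ) : ℂ :=
  cexp (Real.pi * I * τ / 2 + 2 * Real.pi * I * x) * jacobiTheta₂ (2 * x + τ) (2 * τ)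

lemma thS0_half (τ x : ℂ) : thS0 τ (x + 1 / 2) = thS0 τ x := by
  unfold thS0
  rw [show 2 * (x + 1 / 2) = 2 * x + 1 by ring, jacobiTheta₂_add_left]

lemma thS1_half (τ x : ℂ) : thS1 τ (x + 1 / 2) = - thS1 τ x := by
  unfold thS1
  rw [show 2 * (x + 1 / 2) + τ = 2 * x + τ + 1 by ring, jacobiTheta₂_add_left,
    show (Real.pi : ℂ) * I * τ / 2 + 2 * Real.pi * I * (x + 1 / 2) =
      (Real.pi * I * τ / 2 + 2 * Real.pi * I * x) + Real.pi * I by ring,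
    Complex.exp_add _ (Real.pi * I), Complex.exp_pi_mul_I]
  ring

lemma thS0_tau (τ x : ℂ) : thS0 τ (x + τ / 2) =
    cexp (-(Real.pi * I * τ / 2 + 2 * Real.pi * I * x)) * thS1 τ x := by
  unfold thS0 thS1
  rw [← mul_assoc, ← Complex.exp_add, neg_add_cancel, Complex.exp_zero, one_mul]
  congr 1
  ring

lemma thS1_tau (τ x : ℂ) : thS1 τ (x + τ / 2) =
    cexp (-(Real.pi * I * τ / 2 + 2 * Real.pi * I * x)) * thS0 τ x := by
  unfold thS0 thS1
  rw [show 2 * (x + τ / 2) + τ = 2 * x + 2 * τ by ring, jacobiTheta₂_add_left',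
    ← mul_assoc, ← Complex.exp_add]
  congr 2
  ring

lemma theta1_eq (z τ : ℂ) : jacobiTheta1 z τ =
    -I * (cexp (Real.pi * I * τ / 4 + Real.pi * I * z) *
      jacobiTheta₂ (z + 1 / 2 + τ / 2) τ) := by
  unfold jacobiTheta1 jacobiTheta₂
  congr 1
  refine Eq.trans (tsum_congr fun n => ?_) (tsum_mul_left (f := fun n : ℤ =>
    jacobiTheta₂_term n (z + 1 / 2 + τ / 2) τ))
  rw [jacobiTheta₂_term, ← Complex.exp_add]
  have : (-1 : ℂ) ^ n = cexp (n * (Real.pi * I)) := by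
    rw [Complex.exp_int_mul, Complex.exp_pi_mul_I]
  rw [this, ← Complex.exp_add]
  congr 1
  ring

lemma theta1_neg (z τ : ℂ) : jacobiTheta1 (-z) τ = - jacobiTheta1 z τ := by
  rw [theta1_eq, theta1_eq]
  have h1 : jacobiTheta₂ (-z + 1 / 2 + τ / 2) τ = jacobiTheta₂ (z - 1 / 2 - τ / 2) τ := by
    rw [← jacobiTheta₂_neg_left]; congr 1; ring
  have h2 : jacobiTheta₂ (z + 1 / 2 + τ / 2) τ =
      cexp (-Real.pi * I * (τ + 2 * (z - 1 / 2 - τ / 2))) * jacobiTheta₂ (z - 1 / 2 - τ / 2) τ := by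
    rw [← jacobiTheta₂_add_left', ← jacobiTheta₂_add_left (z - 1 / 2 - τ / 2 + τ)]; congr 1; ring
  rw [h1, h2]
  have h3 : cexp (Real.pi * I * τ / 4 + Real.pi * I * z) *
      cexp (-Real.pi * I * (τ + 2 * (z - 1 / 2 - τ / 2))) =
      - cexp (Real.pi * I * τ / 4 + Real.pi * I * -z) := by
    rw [← Complex.exp_add, show (Real.pi : ℂ) * I * τ / 4 + Real.pi * I * z +
      -Real.pi * I * (τ + 2 * (z - 1 / 2 - τ / 2)) =
      Real.pi * I * τ / 4 + Real.pi * I * -z + Real.pi * I by ring, Complex.exp_add _ (Real.pi * I),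
      Complex.exp_pi_mul_I]
    ring
  linear_combination I * jacobiTheta₂ (z - 1 / 2 - τ / 2) τ * (-h3)

def parMap : (ℤ × ℤ) ⊕ (ℤ × ℤ) → ℤ × ℤ
  | Sum.inl p => (p.1 + p.2, p.1 - p.2)
  | Sum.inr p => (p.1 + p.2 + 1, p.1 - p.2)

lemma parMap_bij : Function.Bijective parMap := by
  constructor
  · rintro (⟨a, b⟩ | ⟨a, b⟩) (⟨c, d⟩ | ⟨c, d⟩) h <;>
      simp only [parMap, Prod.mk.injEq, Sum.inl.injEq, Sum.inr.injEq, reduceCtorEq] at h ⊢ <;> omega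
  · rintro ⟨n, m⟩
    rcases Int.even_or_odd (n + m) with ⟨k, hk⟩ | ⟨k, hk⟩
    · refine ⟨Sum.inl (k, n - k), ?_⟩
      simp only [parMap, Prod.mk.injEq]; omega
    · refine ⟨Sum.inr (k, n - k - 1), ?_⟩
      simp only [parMap, Prod.mk.injEq]; omega

lemma theta2_prod (τ : ℂ) (hτ : 0 < τ.im) (x y : ℂ) :
    jacobiTheta₂ (x + y) τ * jacobiTheta₂ (x - y) τ =
      thS0 τ x * thS0 τ y + thS1 τ x * thS1 τ y := by
  have hτ2 : 0 < (2 * τ).im := by simpa using hτ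
  have key : ∀ (t : ℂ), 0 < t.im → ∀ a b : ℂ,
      HasSum (fun p : ℤ × ℤ => jacobiTheta₂_term p.1 a t * jacobiTheta₂_term p.2 b t)
        (jacobiTheta₂ a t * jacobiTheta₂ b t) := by
    intro t ht a b
    have ha := (summable_jacobiTheta₂_term_iff a t).2 ht
    have hb := (summable_jacobiTheta₂_term_iff b t).2 ht
    unfold jacobiTheta₂
    rw [tsum_mul_tsum_of_summable_norm ha.norm hb.norm]
    exact (summable_mul_of_summable_norm ha.norm hb.norm).hasSum
  have h := (Equiv.ofBijective parMap parMap_bij).hasSum_iff.2 (key τ hτ (x + y) (x - y))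
  refine h.unique (HasSum.sum ?_ ?_)
  · unfold thS0
    convert key (2 * τ) hτ2 (2 * x) (2 * y) using 1
    ext p
    simp only [Function.comp, Equiv.ofBijective_apply, parMap, jacobiTheta₂_term, ← Complex.exp_add]
    congr 1
    push_cast
    ring
  · unfold thS1
    have := (key (2 * τ) hτ2 (2 * x + τ) (2 * y + τ)).mul_left
      (cexp (Real.pi * I * τ / 2 + 2 * Real.pi * I * x) *
        cexp (Real.pi * I * τ / 2 + 2 * Real.pi * I * y))
    convert this using 1
    · rfl
    · ext p
      simp only [Function.comp, Equiv.ofBijective_apply, parMap, jacobiTheta₂_term,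
        ← Complex.exp_add]
      congr 1
      push_cast
      ring
    · ring

lemma theta1_prod (τ : ℂ) (hτ : 0 < τ.im) (x y : ℂ) :
    jacobiTheta1 (x + y) τ * jacobiTheta1 (x - y) τ =
      thS0 τ x * thS1 τ y - thS1 τ x * thS0 τ y := by
  rw [theta1_eq, theta1_eq]
  have h := theta2_prod τ hτ (x + 1 / 2 + τ / 2) y
  rw [thS0_tau, thS1_tau, thS0_half, thS1_half] at h
  rw [show x + y + 1 / 2 + τ / 2 = x + 1 / 2 + τ / 2 + y by ring,
    show x - y + 1 / 2 + τ / 2 = x + 1 / 2 + τ / 2 - y by ring]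
  have e : cexp (Real.pi * I * τ / 4 + Real.pi * I * (x + y)) *
      cexp (Real.pi * I * τ / 4 + Real.pi * I * (x - y)) *
      cexp (-(Real.pi * I * τ / 2 + 2 * Real.pi * I * (x + 1 / 2))) = -1 := by
    rw [← Complex.exp_add, ← Complex.exp_add, ← Complex.exp_pi_mul_I, ← Complex.exp_periodic.sub_eq]
    rw [← Complex.exp_periodic.sub_eq (Real.pi * I)]
    rw [← Complex.exp_periodic]
    congr 1
    ring
  linear_combination (-1) * (cexp (Real.pi * I * τ / 4 + Real.pi * I * (x + y)) *
      cexp (Real.pi * I * τ / 4 + Real.pi * I * (x - y))) * h +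
    (thS1 τ x * thS0 τ y - thS0 τ x * thS1 τ y) * e
      + (jacobiTheta₂ (x + 1 / 2 + τ / 2 + y) τ) * (jacobiTheta₂ (x + 1 / 2 + τ / 2 - y) τ) *
       (cexp (Real.pi * I * τ / 4 + Real.pi * I * (x + y)) *
      cexp (Real.pi * I * τ / 4 + Real.pi * I * (x - y))) * I_sq

lemma weier (τ : ℂ) (hτ : 0 < τ.im) (x y u v : ℂ) :
    (jacobiTheta1 (x + y) τ * jacobiTheta1 (x - y) τ) *
      (jacobiTheta1 (u + v) τ * jacobiTheta1 (u - v) τ) +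
    (jacobiTheta1 (x + u) τ * jacobiTheta1 (x - u) τ) *
      (jacobiTheta1 (v + y) τ * jacobiTheta1 (v - y) τ) +
    (jacobiTheta1 (x + v) τ * jacobiTheta1 (x - v) τ) *
      (jacobiTheta1 (y + u) τ * jacobiTheta1 (y - u) τ) = 0 := by
  simp only [theta1_prod τ hτ]
  ring

lemma theta2_ne (τ : ℂ) (hτ : 0 < τ.im) : ∃ z, jacobiTheta₂ z τ ≠ 0 := by
  by_contra! hc
  let f : ℤ → C(ℝ, ℂ) := fun n => ⟨fun x => jacobiTheta₂_term n x τ, by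
    unfold jacobiTheta₂_term; fun_prop⟩
  have hs : Summable fun n : ℤ =>
      ‖(f n).restrict (⟨Set.uIcc 0 1, isCompact_uIcc⟩ : TopologicalSpace.Compacts ℝ)‖ := by
    refine Summable.of_nonneg_of_le (fun _ => norm_nonneg _) (fun n => ?_)
      ((summable_jacobiTheta₂_term_iff 0 τ).2 hτ).norm
    rw [ContinuousMap.norm_le _ (norm_nonneg _)]
    rintro ⟨x, hx⟩
    simp [f, norm_jacobiTheta₂_term]
  have h := intervalIntegral.hasSum_intervalIntegral_of_summable_norm hs
  have h0 : ∀ x : ℝ, ∑' n, f n x = 0 := fun x => hc x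
  simp only [h0, intervalIntegral.integral_zero] at h
  have h1 : HasSum (fun n : ℤ => ∫ x in (0:ℝ)..1, f n x) 1 := by
    have : (1 : ℂ) = ∫ x in (0:ℝ)..1, f 0 x := by
      simp [f, jacobiTheta₂_term]
    rw [this]
    refine hasSum_single _ fun n hn => ?_
    have hc : (2 * Real.pi * I * n : ℂ) ≠ 0 := by
      simp [hn, Real.pi_ne_zero]
    simp only [f, ContinuousMap.coe_mk, jacobiTheta₂_term, Complex.exp_add]
    rw [intervalIntegral.integral_mul_const, integral_exp_mul_complex hc]
    have : cexp (2 * Real.pi * I * n) = 1 := by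
      rw [mul_comm]; exact Complex.exp_int_mul_two_pi_mul_I n
    simp [this]
  exact zero_ne_one (h.unique h1)

lemma S_ne (τ : ℂ) (hτ : 0 < τ.im) (x : ℂ) : thS0 τ x ≠ 0 ∨ thS1 τ x ≠ 0 := by
  by_contra! hc
  have hT : Differentiable ℂ (fun z => jacobiTheta₂ z τ) := fun z =>
    differentiableAt_jacobiTheta₂_fst z hτ
  have h : ∀ y, jacobiTheta₂ (x + y) τ * jacobiTheta₂ (x - y) τ = 0 := fun y => by
    rw [theta2_prod τ hτ, hc.1, hc.2]; ring
  have a1 : AnalyticOnNhd ℂ (fun y => jacobiTheta₂ (x + y) τ) Set.univ :=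
    (Differentiable.differentiableOn (hT.comp (by fun_prop : Differentiable ℂ fun y => x + y))).analyticOnNhd
      isOpen_univ
  have a2 : AnalyticOnNhd ℂ (fun y => jacobiTheta₂ (x - y) τ) Set.univ :=
    (Differentiable.differentiableOn (hT.comp (by fun_prop : Differentiable ℂ fun y => x - y))).analyticOnNhd
      isOpen_univ
  obtain ⟨z, hz⟩ := theta2_ne τ hτ
  rcases AnalyticOnNhd.eq_zero_or_eq_zero_of_mul_eq_zero a1 a2 (fun y _ => h y)
    isPreconnected_univ with h | h
  · apply hz; simpa using h (z - x) trivial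
  · apply hz; simpa using h (x - z) trivial

lemma liouville_periodic (τ : ℂ) (hτ : 0 < τ.im) (L : ℂ → ℂ) (hL : Differentiable ℂ L)
    (h1 : Function.Periodic L 1) (h2 : Function.Periodic L τ) (z w : ℂ) : L z = L w := by
  refine hL.apply_eq_apply_of_bounded ?_ z w
  have hK : IsCompact (L '' Metric.closedBall 0 (1 + ‖τ‖)) :=
    (isCompact_closedBall _ _).image hL.continuous
  refine hK.isBounded.subset ?_
  rintro _ ⟨z, rfl⟩
  set n : ℤ := ⌊z.im / τ.im⌋ with hn
  set a : ℝ := Int.fract (z.im / τ.im) with ha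
  set r : ℝ := z.re - (z.im / τ.im) * τ.re with hr
  have hz : z = r + (z.im / τ.im : ℝ) * τ := by
    apply Complex.ext
    · simp [hr, -ofReal_div]
    · simp [-ofReal_div]
      field_simp
  refine ⟨(Int.fract r : ℝ) + (a : ℝ) * τ, ?_, ?_⟩
  · rw [mem_closedBall_zero_iff]
    refine (norm_add_le _ _).trans ?_
    rw [norm_mul, Complex.norm_real, Complex.norm_real, Real.norm_of_nonneg (Int.fract_nonneg _),
      Real.norm_of_nonneg (Int.fract_nonneg _)]
    have := (Int.fract_lt_one r).le
    have := mul_le_of_le_one_left (norm_nonneg τ) (Int.fract_lt_one (z.im / τ.im)).le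
    linarith
  · have e : z = (Int.fract r : ℝ) + (a : ℝ) * τ + (n : ℂ) * τ + ((⌊r⌋ : ℤ) : ℂ) * 1 := by
      conv_lhs => rw [hz, ← Int.floor_add_fract r, ← Int.floor_add_fract (z.im / τ.im)]
      push_cast
      ring
    rw [e, h1.int_mul, h2.int_mul]

lemma lam_exists (τ : ℂ) (hτ : 0 < τ.im) (z₀ : ℂ) (h0 : jacobiTheta1 z₀ τ = 0) :
    ∃ l : ℂ → ℂ, Differentiable ℂ l ∧ (∀ x, l x ≠ 0) ∧
      (∀ x, thS0 τ (x + z₀) = l x * thS0 τ x) ∧ (∀ x, thS1 τ (x + z₀) = l x * thS1 τ x) := by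
  have hrel : ∀ x, thS0 τ (x + z₀) * thS1 τ x = thS1 τ (x + z₀) * thS0 τ x := fun x => by
    have := theta1_prod τ hτ (x + z₀) x
    rw [show x + z₀ - x = z₀ by ring, h0, mul_zero] at this
    linear_combination -this
  have hT : Differentiable ℂ (fun z => jacobiTheta₂ z (2 * τ)) := fun z =>
    differentiableAt_jacobiTheta₂_fst z (by simpa using hτ)
  have d0 : Differentiable ℂ (thS0 τ) := by
    unfold thS0
    exact hT.comp (by fun_prop : Differentiable ℂ fun y : ℂ => 2 * y)
  have d1 : Differentiable ℂ (thS1 τ) := by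
    unfold thS1
    exact Differentiable.mul (by fun_prop)
      (hT.comp (by fun_prop : Differentiable ℂ fun y : ℂ => 2 * y + τ))
  have d0' : Differentiable ℂ (fun x => thS0 τ (x + z₀)) :=
    d0.comp (by fun_prop : Differentiable ℂ fun y => y + z₀)
  have d1' : Differentiable ℂ (fun x => thS1 τ (x + z₀)) :=
    d1.comp (by fun_prop : Differentiable ℂ fun y => y + z₀)
  classical
  let l : ℂ → ℂ := fun x => if thS0 τ x = 0 then thS1 τ (x + z₀) / thS1 τ x
    else thS0 τ (x + z₀) / thS0 τ x
  have l0 : ∀ x, thS0 τ x ≠ 0 → l x = thS0 τ (x + z₀) / thS0 τ x := fun x hx => by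
    simp [l, hx]
  have l1 : ∀ x, thS1 τ x ≠ 0 → l x = thS1 τ (x + z₀) / thS1 τ x := fun x hx => by
    by_cases h : thS0 τ x = 0
    · simp [l, h]
    · rw [l0 x h, div_eq_div_iff h hx, hrel]
  have e0 : ∀ x, thS0 τ (x + z₀) = l x * thS0 τ x := fun x => by
    by_cases h : thS0 τ x = 0
    · have h1 : thS1 τ x ≠ 0 := (S_ne τ hτ x).resolve_left (by simpa using h)
      have := hrel x
      rw [h, mul_zero] at this
      rw [h, mul_zero]
      exact (mul_eq_zero.1 this).resolve_right h1
    · rw [l0 x h]; field_simp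
  have e1 : ∀ x, thS1 τ (x + z₀) = l x * thS1 τ x := fun x => by
    by_cases h : thS1 τ x = 0
    · have h1 : thS0 τ x ≠ 0 := (S_ne τ hτ x).resolve_right (by simpa using h)
      have := hrel x
      rw [h, mul_zero] at this
      rw [h, mul_zero]
      exact (mul_eq_zero.1 this.symm).resolve_right h1
    · rw [l1 x h]; field_simp
  refine ⟨l, fun x => ?_, fun x hx => ?_, e0, e1⟩
  · rcases S_ne τ hτ x with h | h
    · have : l =ᶠ[nhds x] fun x => thS0 τ (x + z₀) / thS0 τ x := by
        filter_upwards [d0.continuous.continuousAt.eventually_ne h] with y hy using l0 y hy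
      exact ((d0' x).div (d0 x) h).congr_of_eventuallyEq this
    · have : l =ᶠ[nhds x] fun x => thS1 τ (x + z₀) / thS1 τ x := by
        filter_upwards [d1.continuous.continuousAt.eventually_ne h] with y hy using l1 y hy
      exact ((d1' x).div (d1 x) h).congr_of_eventuallyEq this
  · have a := e0 x
    have b := e1 x
    rw [hx, zero_mul] at a b
    rcases S_ne τ hτ (x + z₀) with h | h
    · exact h a
    · exact h b

lemma theta1_zero (τ : ℂ) (hτ : 0 < τ.im) (z₀ : ℂ) (h0 : jacobiTheta1 z₀ τ = 0) :
    z₀ ∈ latticeZtau τ := by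
  obtain ⟨l, hd, hn, e0, e1⟩ := lam_exists τ hτ z₀ h0
  have p1 : ∀ x, l (x + 1 / 2) = l x := fun x => by
    have a := e0 (x + 1 / 2)
    have b := e1 (x + 1 / 2)
    rw [add_right_comm, thS0_half, thS0_half, e0] at a
    rw [add_right_comm, thS1_half, thS1_half, e1] at b
    rcases S_ne τ hτ x with h | h
    · exact (mul_right_cancel₀ h a).symm
    · refine (mul_right_cancel₀ h ?_).symm
      linear_combination -b
  have p2 : ∀ x, l (x + τ / 2) = cexp (-(2 * Real.pi * I * z₀)) * l x := fun x => by
    have a := e0 (x + τ / 2)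
    have b := e1 (x + τ / 2)
    have E : cexp (-(Real.pi * I * τ / 2 + 2 * Real.pi * I * (x + z₀))) =
      cexp (-(Real.pi * I * τ / 2 + 2 * Real.pi * I * x)) * cexp (-(2 * Real.pi * I * z₀)) := by
      rw [← Complex.exp_add]; congr 1; ring
    rw [add_right_comm, thS0_tau, thS0_tau, e1, E] at a
    rw [add_right_comm, thS1_tau, thS1_tau, e0, E] at b
    have En := Complex.exp_ne_zero (-(Real.pi * I * τ / 2 + 2 * Real.pi * I * x))
    rcases S_ne τ hτ x with h | h
    · refine mul_right_cancel₀ (mul_ne_zero En h) ?_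
      linear_combination -b
    · refine mul_right_cancel₀ (mul_ne_zero En h) ?_
      linear_combination -a
  have dd : Differentiable ℂ (deriv l) := by
    intro x
    exact (hd.analyticAt x).deriv.differentiableAt
  have q1 : ∀ x, deriv l (x + 1 / 2) = deriv l x := fun x => by
    rw [← deriv_comp_add_const]; congr 1; funext y; exact p1 y
  have q2 : ∀ x, deriv l (x + τ / 2) = cexp (-(2 * Real.pi * I * z₀)) * deriv l x := fun x => by
    rw [← deriv_comp_add_const, funext p2, deriv_const_mul _ (hd x)]
  let L : ℂ → ℂ := fun x => deriv l x / l x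
  have r1 : ∀ x, L (x + 1 / 2) = L x := fun x => by simp only [L, p1, q1]
  have r2 : ∀ x, L (x + τ / 2) = L x := fun x => by
    simp only [L, p2, q2]
    rw [mul_div_mul_left _ _ (Complex.exp_ne_zero _)]
  have hL : Differentiable ℂ L := fun x => (dd x).div (hd x) (hn x)
  have hconst := liouville_periodic τ hτ L hL
    (fun x => by rw [show x + 1 = x + 1 / 2 + 1 / 2 by ring, r1, r1])
    (fun x => by rw [show x + τ = x + τ / 2 + τ / 2 by ring, r2, r2])
  set a := L 0 with ha
  have hda : ∀ x, deriv l x = a * l x := fun x => by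
    rw [ha, hconst 0 x]; simp only [L]; field_simp [hn x]
  have hc : ∀ x, l x * cexp (-(a * x)) = l 0 := fun x => by
    have : ∀ x, HasDerivAt (fun x => l x * cexp (-(a * x))) 0 x := fun x => by
      have h1 := (hd x).hasDerivAt
      have h2 : HasDerivAt (fun x => cexp (-(a * x))) (cexp (-(a * x)) * (-(a * 1))) x :=
        (((hasDerivAt_id x).const_mul a).neg).cexp
      refine (h1.mul h2).congr_deriv ?_
      rw [hda]; ring
    have := is_const_of_deriv_eq_zero (fun x => (this x).differentiableAt)
      (fun x => (this x).deriv) x 0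
    simpa using this
  have hl : ∀ x, l x = l 0 * cexp (a * x) := fun x => by
    rw [← hc x, mul_assoc, ← Complex.exp_add]; simp
  have s1 : cexp (a * (1 / 2)) = 1 := by
    have := p1 0
    rw [hl, zero_add] at this
    exact mul_left_cancel₀ (hn 0) (by rw [this, mul_one])
  have s2 : cexp (a * (τ / 2) + 2 * Real.pi * I * z₀) = 1 := by
    have := p2 0
    rw [hl, zero_add, mul_comm _ (l 0)] at this
    rw [Complex.exp_add, mul_left_cancel₀ (hn 0) this, ← Complex.exp_add]
    simp
  obtain ⟨k, hk⟩ := Complex.exp_eq_one_iff.1 s1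
  obtain ⟨m, hm⟩ := Complex.exp_eq_one_iff.1 s2
  refine ⟨m, -k, ?_⟩
  have hpi : (2 * Real.pi * I : ℂ) ≠ 0 := Complex.two_pi_I_ne_zero
  refine mul_left_cancel₀ hpi ?_
  push_cast
  linear_combination hm - τ * hk

/-- **Three-term identity for `σ`:** for `Im τ > 0` and `z₁, z₂, w₁, w₂ ∈ ℂ` with none of
`z₁, z₂, w₁, w₂, w₁ + w₂, z₁ − z₂` in the lattice `ℤ + τℤ`,
`σ_{w₁}(z₁) σ_{w₂}(z₂) = σ_{w₁+w₂}(z₁) σ_{w₂}(z₂−z₁) + σ_{w₁+w₂}(z₂) σ_{w₁}(z₁−z₂)`. -/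
theorem sigmaTheta_three_term (τ : ℂ) (hτ : 0 < τ.im) (z₁ z₂ w₁ w₂ : ℂ)
    (hz₁ : z₁ ∉ latticeZtau τ) (hz₂ : z₂ ∉ latticeZtau τ)
    (hw₁ : w₁ ∉ latticeZtau τ) (hw₂ : w₂ ∉ latticeZtau τ)
    (hw₁₂ : w₁ + w₂ ∉ latticeZtau τ) (hz₁₂ : z₁ - z₂ ∉ latticeZtau τ) :
    sigmaTheta w₁ z₁ τ * sigmaTheta w₂ z₂ τ =
      sigmaTheta (w₁ + w₂) z₁ τ * sigmaTheta w₂ (z₂ - z₁) τ +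
        sigmaTheta (w₁ + w₂) z₂ τ * sigmaTheta w₁ (z₁ - z₂) τ := by
  have W := weier τ hτ ((z₁ + z₂ - w₁ - w₂) / 2) ((z₁ - z₂ - w₁ + w₂) / 2)
    ((z₁ - z₂ + w₁ + w₂) / 2) ((w₁ + w₂ - z₁ + z₂) / 2)
  have n1 : jacobiTheta1 z₁ τ ≠ 0 := fun h => hz₁ (theta1_zero τ hτ _ h)
  have n2 : jacobiTheta1 z₂ τ ≠ 0 := fun h => hz₂ (theta1_zero τ hτ _ h)
  have n3 : jacobiTheta1 w₁ τ ≠ 0 := fun h => hw₁ (theta1_zero τ hτ _ h)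
  have n4 : jacobiTheta1 w₂ τ ≠ 0 := fun h => hw₂ (theta1_zero τ hτ _ h)
  have n5 : jacobiTheta1 (w₁ + w₂) τ ≠ 0 := fun h => hw₁₂ (theta1_zero τ hτ _ h)
  have n6 : jacobiTheta1 (z₁ - z₂) τ ≠ 0 := fun h => hz₁₂ (theta1_zero τ hτ _ h)
  have o1 : jacobiTheta1 (z₂ - z₁) τ = - jacobiTheta1 (z₁ - z₂) τ := by
    rw [← theta1_neg]; congr 1; ring
  have W := weier τ hτ ((z₁ + z₂ - w₁ - w₂) / 2) ((z₁ - z₂ - w₁ + w₂) / 2)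
    ((z₁ - z₂ + w₁ + w₂) / 2) ((w₁ + w₂ - z₁ + z₂) / 2)
  rw [show (z₁ + z₂ - w₁ - w₂) / 2 + (z₁ - z₂ - w₁ + w₂) / 2 = z₁ - w₁ by ring,
    show (z₁ + z₂ - w₁ - w₂) / 2 - (z₁ - z₂ - w₁ + w₂) / 2 = z₂ - w₂ by ring,
    show (z₁ - z₂ + w₁ + w₂) / 2 + (w₁ + w₂ - z₁ + z₂) / 2 = w₁ + w₂ by ring,
    show (z₁ - z₂ + w₁ + w₂) / 2 - (w₁ + w₂ - z₁ + z₂) / 2 = z₁ - z₂ by ring,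
    show (z₁ + z₂ - w₁ - w₂) / 2 + (z₁ - z₂ + w₁ + w₂) / 2 = z₁ by ring,
    show (z₁ + z₂ - w₁ - w₂) / 2 - (z₁ - z₂ + w₁ + w₂) / 2 = z₂ - (w₁ + w₂) by ring,
    show (w₁ + w₂ - z₁ + z₂) / 2 + (z₁ - z₂ - w₁ + w₂) / 2 = w₂ by ring,
    show (w₁ + w₂ - z₁ + z₂) / 2 - (z₁ - z₂ - w₁ + w₂) / 2 = -(z₁ - z₂ - w₁) by ring,
    show (z₁ + z₂ - w₁ - w₂) / 2 + (w₁ + w₂ - z₁ + z₂) / 2 = z₂ by ring,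
    show (z₁ + z₂ - w₁ - w₂) / 2 - (w₁ + w₂ - z₁ + z₂) / 2 = z₁ - (w₁ + w₂) by ring,
    show (z₁ - z₂ - w₁ + w₂) / 2 + (z₁ - z₂ + w₁ + w₂) / 2 = -(z₂ - z₁ - w₂) by ring,
    show (z₁ - z₂ - w₁ + w₂) / 2 - (z₁ - z₂ + w₁ + w₂) / 2 = -w₁ by ring] at W
  simp only [theta1_neg] at W
  unfold sigmaTheta
  rw [o1]
  simp only [theta1_neg]
  generalize jacobiTheta1 z₁ τ = Z1 at *
  generalize jacobiTheta1 z₂ τ = Z2 at *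
  generalize jacobiTheta1 w₁ τ = W1 at *
  generalize jacobiTheta1 w₂ τ = W2 at *
  generalize jacobiTheta1 (w₁ + w₂) τ = W12 at *
  generalize jacobiTheta1 (z₁ - z₂) τ = Z12 at *
  field_simp
  linear_combination jacobiTheta1'zero τ ^ 2 * W
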